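/- arXiv:1108.4380 — 7 statements merged into one kernel-verified Lean document; each statement's English description precedes it below -/
import Mathlib

section
/- Let p ∈ ℝ[x₁,…,xₙ] with p(0) = 1 and deg p = d. Suppose q ∈ ℝ[x₁,…,xₙ] is nonzero and q² · 𝓗(p) = 𝓠ᵀ𝓠 for some k×d matrix 𝓠 with polynomial entries. Then there exist a nonzero homogeneous polynomial q₀ ∈ ℝ[x₁,…,xₙ] of some degree r and a k×d matrix 𝓠₀ with polynomial entries, such that every entry in the i-th column of 𝓠₀ is homogeneous of degree r + i − 1 (or zero) and q₀² · 𝓗(p) = 𝓠₀ᵀ𝓠₀. -/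
open Matrix

/-- Write `p = Σ_{i=0}^d p_i` with `p_i` homogeneous of degree `i`, and let
`P(x,t) = Σ_{i=0}^d p_i t^{d-i}` be the homogenization of `p` with respect to `t`.
This is the companion matrix `L_t` of `P` (as a monic polynomial in `t` of degree `d`):
subdiagonal entries `1`, last column `(-p_d, -p_{d-1}, …, -p_1)ᵀ`. -/
noncomputable def companionM {n : ℕ} (d : ℕ) (p : MvPolynomial (Fin n) ℝ) :
    Matrix (Fin d) (Fin d) (MvPolynomial (Fin n) ℝ) := fun i j =>
  if (j : ℕ) = d - 1 then -(MvPolynomial.homogeneousComponent (d - (i : ℕ)) p)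
  else if (i : ℕ) = (j : ℕ) + 1 then 1 else 0

/-- The parametrized Hermite matrix `𝓗(p)` of `p` (for `p` of degree `d`): the `d × d`
matrix over `ℝ[x₁,…,xₙ]` whose `(i,j)`-entry (1-based) is the Newton sum
`N_{i+j-2}(P) = trace (L_t^{i+j-2})`. -/
noncomputable def hermiteM {n : ℕ} (d : ℕ) (p : MvPolynomial (Fin n) ℝ) :
    Matrix (Fin d) (Fin d) (MvPolynomial (Fin n) ℝ) := fun i j =>
  Matrix.trace (companionM d p ^ ((i : ℕ) + (j : ℕ)))

/-- A polynomial `p ∈ ℝ[x₁,…,xₙ]` with `p(0) = 1` is a real-zero polynomial if for every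
`a ∈ ℝⁿ` all complex roots of the univariate polynomial `t ↦ p(ta)` are real. -/
def IsRealZero {n : ℕ} (p : MvPolynomial (Fin n) ℝ) : Prop :=
  MvPolynomial.constantCoeff p = 1 ∧
  ∀ (a : Fin n → ℝ) (z : ℂ),
    (MvPolynomial.aeval (fun i => z * algebraMap ℝ ℂ (a i))) p = 0 → z.im = 0

/-- The symmetric linear matrix polynomial `𝓜 = x₁M₁ + ⋯ + xₙMₙ` determined by
matrices `M₁, …, Mₙ`. -/
noncomputable def pencil {n k : ℕ} (M : Fin n → Matrix (Fin k) (Fin k) ℝ) :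
    Matrix (Fin k) (Fin k) (MvPolynomial (Fin n) ℝ) := fun i j =>
  ∑ l, MvPolynomial.X l * MvPolynomial.C (M l i j)

namespace MvPolynomial

variable {σ R : Type*} [CommSemiring R]

theorem coeff_eq_zero_of_totalDegree_lt_degree {f : MvPolynomial σ R} {s : σ →₀ ℕ}
    (h : f.totalDegree < s.degree) : coeff s f = 0 := by
  by_contra hs
  exact absurd (le_totalDegree (mem_support_iff.mpr hs)) (not_le.mpr h)

/-- Top-degree components are multiplicative. -/
theorem homogeneousComponent_mul_of_totalDegree_le {f g : MvPolynomial σ R} {a b : ℕ}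
    (hf : f.totalDegree ≤ a) (hg : g.totalDegree ≤ b) :
    homogeneousComponent (a + b) (f * g) =
      homogeneousComponent a f * homogeneousComponent b g := by
  classical
  ext s
  rw [coeff_homogeneousComponent, coeff_mul, coeff_mul, ← Finset.sum_const_zero,
    ← Finset.sum_ite_irrel]
  refine Finset.sum_congr rfl fun x hx => ?_
  have hs : x.1.degree + x.2.degree = s.degree := by
    rw [← Finset.HasAntidiagonal.mem_antidiagonal.mp hx, map_add]
  rw [coeff_homogeneousComponent, coeff_homogeneousComponent]
  rcases lt_or_ge a x.1.degree with h₁ | h₁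
  · simp [coeff_eq_zero_of_totalDegree_lt_degree (hf.trans_lt h₁)]
  rcases lt_or_ge b x.2.degree with h₂ | h₂
  · simp [coeff_eq_zero_of_totalDegree_lt_degree (hg.trans_lt h₂)]
  by_cases h₃ : x.1.degree = a <;> by_cases h₄ : x.2.degree = b <;>
    simp only [h₃, h₄, if_true, if_false, mul_zero, zero_mul, ite_eq_left_iff,
      ite_eq_right_iff] <;> intro h <;> omega

theorem homogeneousComponent_totalDegree_ne_zero {f : MvPolynomial σ R} (hf : f ≠ 0) :
    homogeneousComponent f.totalDegree f ≠ 0 := by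
  obtain ⟨s, hs, h⟩ := Finset.exists_mem_eq_sup f.support (support_nonempty.mpr hf)
    fun s => s.sum fun _ e => e
  intro h0
  have hc := congrArg (coeff s) h0
  rw [coeff_homogeneousComponent, if_pos (show s.degree = f.totalDegree from h.symm),
    coeff_zero] at hc
  exact mem_support_iff.mp hs hc

theorem eq_zero_of_sum_sq_eq_zero {ι : Type*} [Fintype ι] {f : ι → MvPolynomial σ ℝ}
    (h : ∑ i, f i * f i = 0) (i : ι) : f i = 0 := by
  refine funext fun x => ?_
  have hx := congrArg (eval x) h
  simp only [map_sum, map_mul, map_zero] at hx ⊢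
  rw [Finset.sum_eq_zero_iff_of_nonneg fun _ _ => mul_self_nonneg _] at hx
  exact mul_self_eq_zero.mp (hx i (Finset.mem_univ i))

/-- Leading forms do not cancel in a sum of squares of real polynomials. -/
theorem totalDegree_le_of_totalDegree_sum_sq_le {ι : Type*} [Fintype ι]
    {f : ι → MvPolynomial σ ℝ} {m : ℕ} (h : (∑ i, f i * f i).totalDegree ≤ m + m) (i : ι) :
    (f i).totalDegree ≤ m := by
  obtain ⟨j, -, hj⟩ := Finset.exists_max_image Finset.univ (fun i => (f i).totalDegree)
    ⟨i, Finset.mem_univ i⟩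
  refine (hj i (Finset.mem_univ i)).trans ?_
  by_contra! hlt
  have hsum : ∑ l, homogeneousComponent (f j).totalDegree (f l) *
      homogeneousComponent (f j).totalDegree (f l) = 0 := by
    rw [← homogeneousComponent_eq_zero ((f j).totalDegree + (f j).totalDegree)
      (∑ i, f i * f i) (by omega), map_sum]
    exact Finset.sum_congr rfl fun l hl =>
      (homogeneousComponent_mul_of_totalDegree_le (hj l hl) (hj l hl)).symm
  refine homogeneousComponent_totalDegree_ne_zero (f := f j) ?_ (eq_zero_of_sum_sq_eq_zero hsum j)
  rintro h0
  simp [h0] at hlt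

end MvPolynomial

theorem degree_add_eq_of_coeff_companionM_pow_ne_zero {n d : ℕ} (p : MvPolynomial (Fin n) ℝ)
    (m : ℕ) (i j : Fin d) (s : Fin n →₀ ℕ)
    (hs : MvPolynomial.coeff s ((companionM d p ^ m) i j) ≠ 0) : s.degree + i = j + m := by
  classical
  induction m generalizing j s with
  | zero =>
    rw [pow_zero, Matrix.one_apply] at hs
    split_ifs at hs with hij
    · rw [MvPolynomial.coeff_one] at hs
      split_ifs at hs with h
      · simp [← h, hij]
      · exact absurd rfl hs
    · exact absurd (MvPolynomial.coeff_zero s) hs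
  | succ m ih =>
    rw [pow_succ, Matrix.mul_apply, MvPolynomial.coeff_sum] at hs
    obtain ⟨l, -, hl⟩ := Finset.exists_ne_zero_of_sum_ne_zero hs
    rw [MvPolynomial.coeff_mul] at hl
    obtain ⟨x, hx, hne⟩ := Finset.exists_ne_zero_of_sum_ne_zero hl
    have h₁ := ih l x.1 (left_ne_zero_of_mul hne)
    have h₂ : x.2.degree + l = j + 1 := by
      have h := right_ne_zero_of_mul hne
      unfold companionM at h
      split_ifs at h with hj hlj
      · rw [MvPolynomial.coeff_neg, neg_ne_zero, MvPolynomial.coeff_homogeneousComponent] at h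
        split_ifs at h with hd
        · omega
        · exact absurd rfl h
      · rw [MvPolynomial.coeff_one] at h
        split_ifs at h with h0
        · simp [← h0, hlj]
        · exact absurd rfl h
      · exact absurd (MvPolynomial.coeff_zero _) h
    rw [← Finset.HasAntidiagonal.mem_antidiagonal.mp hx, map_add]
    omega

theorem hermiteM_isHomogeneous {n d : ℕ} (p : MvPolynomial (Fin n) ℝ) (i j : Fin d) :
    (hermiteM d p i j).IsHomogeneous (i + j) := by
  refine MvPolynomial.IsHomogeneous.sum _ _ _ fun l _ s hs => ?_
  have := degree_add_eq_of_coeff_companionM_pow_ne_zero p _ l l s hs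
  change Finsupp.weight (fun _ => 1) s = (i + j : ℕ)
  rw [← Finsupp.degree_eq_weight_one]
  omega

open MvPolynomial in
/-- Suppose `q ≠ 0` and `q² · 𝓗(p) = 𝓠ᵀ𝓠` for a `k × d` polynomial matrix `𝓠`. Then there
exist a nonzero homogeneous polynomial `q₀` of some degree `r` and a `k × d` polynomial
matrix `𝓠₀`, whose entries in the `i`-th column (1-based) are homogeneous of degree
`r + i - 1` (or zero), such that `q₀² · 𝓗(p) = 𝓠₀ᵀ𝓠₀`. -/
theorem hermite_sos_homogenization {n : ℕ} (p : MvPolynomial (Fin n) ℝ) (d : ℕ)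
    (h0 : MvPolynomial.constantCoeff p = 1) (hdeg : p.totalDegree = d)
    (q : MvPolynomial (Fin n) ℝ) (hq : q ≠ 0) (k : ℕ)
    (Q : Matrix (Fin k) (Fin d) (MvPolynomial (Fin n) ℝ))
    (hQ : q ^ 2 • hermiteM d p = Qᵀ * Q) :
    ∃ (q₀ : MvPolynomial (Fin n) ℝ) (r : ℕ)
      (Q₀ : Matrix (Fin k) (Fin d) (MvPolynomial (Fin n) ℝ)),
        q₀ ≠ 0 ∧ q₀.IsHomogeneous r ∧
        (∀ (i : Fin k) (j : Fin d), (Q₀ i j).IsHomogeneous (r + (j : ℕ))) ∧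
        q₀ ^ 2 • hermiteM d p = Q₀ᵀ * Q₀ := by
  have hentry (j l : Fin d) : q ^ 2 * hermiteM d p j l = ∑ i, Q i j * Q i l :=
    congrFun (congrFun hQ j) l
  have hH (j l : Fin d) := hermiteM_isHomogeneous p j l
  have hq2 : (q ^ 2).totalDegree ≤ q.totalDegree + q.totalDegree := by
    rw [pow_two]
    exact totalDegree_mul q q
  have hdegQ (i : Fin k) (j : Fin d) : (Q i j).totalDegree ≤ q.totalDegree + j := by
    refine totalDegree_le_of_totalDegree_sum_sq_le (f := fun i => Q i j) ?_ i
    rw [← hentry]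
    have h₁ := totalDegree_mul (q ^ 2) (hermiteM d p j j)
    have h₂ := (hH j j).totalDegree_le
    omega
  refine ⟨homogeneousComponent q.totalDegree q, q.totalDegree,
    fun i j => homogeneousComponent (q.totalDegree + j) (Q i j),
    homogeneousComponent_totalDegree_ne_zero hq, homogeneousComponent_isHomogeneous _ _,
    fun i j => homogeneousComponent_isHomogeneous _ _, ?_⟩
  ext1 j l
  change homogeneousComponent q.totalDegree q ^ 2 * hermiteM d p j l =
    ∑ i, homogeneousComponent (q.totalDegree + j) (Q i j) *
      homogeneousComponent (q.totalDegree + l) (Q i l)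
  simp_rw [← homogeneousComponent_mul_of_totalDegree_le (hdegQ _ j) (hdegQ _ l)]
  rw [← map_sum, ← hentry, show q.totalDegree + (j : ℕ) + (q.totalDegree + l) =
      q.totalDegree + q.totalDegree + (j + l) by omega,
    homogeneousComponent_mul_of_totalDegree_le hq2 (hH j l).totalDegree_le,
    homogeneousComponent_eq_self (hH j l), pow_two, pow_two,
    homogeneousComponent_mul_of_totalDegree_le le_rfl le_rfl]
end

section
/- Let p ∈ ℝ[x₁,…,xₙ] be a square-free real-zero polynomial of degree d, let q ∈ ℝ[x₁,…,xₙ] be nonzero, and suppose q² · 𝓗(p) = 𝓠ᵀ𝓠 for a k×d matrix 𝓠 with polynomial entries. Then the ℝ[x₁,…,xₙ]-linear map ℝ[x₁,…,xₙ]^d → ℝ[x₁,…,xₙ]^k given by f ↦ 𝓠f is injective: if 𝓠f = 0 then f = 0. -/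
open Matrix

/-- A square matrix over a field of characteristic zero all of whose positive powers have
trace zero is nilpotent. -/
theorem Matrix.isNilpotent_of_forall_trace_pow_eq_zero_of_field {K ι : Type*} [Field K]
    [CharZero K] [Fintype ι] [DecidableEq ι] (A : Matrix ι ι K)
    (h : ∀ m, 0 < m → (A ^ m).trace = 0) : IsNilpotent A := by
  open Polynomial in
  have htr : ∀ s : K[X], (aeval A (X * s)).trace = 0 := by
    intro s
    induction s using Polynomial.induction_on' with
    | add a b ha hb => rw [mul_add, map_add, trace_add, ha, hb, add_zero]
    | monomial m c =>
      rw [X_mul_monomial, aeval_monomial, ← Algebra.smul_def, trace_smul, h _ m.succ_pos, smul_zero]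
  obtain ⟨r, hr, hXr⟩ :=
    exists_eq_pow_rootMultiplicity_mul_and_not_dvd A.charpoly A.charpoly_monic.ne_zero 0
  rw [C_0, sub_zero] at hr hXr
  set a := A.charpoly.rootMultiplicity 0
  obtain ⟨u, v, huv⟩ : IsCoprime (X ^ (a + 1)) r :=
    ((irreducible_X.coprime_iff_not_dvd).2 hXr).pow_left
  have hchar : ∀ w, aeval A (w * (X ^ a * r)) = 0 := fun w => by
    rw [map_mul, ← hr, Matrix.aeval_self_charpoly, mul_zero]
  set e := aeval A (u * X ^ (a + 1)) with he
  have hv : aeval A (v * r) = 1 - e := by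
    rw [eq_sub_iff_add_eq', he, ← map_add, huv, map_one]
  have hidem : IsIdempotentElem e := by
    have : e * (1 - e) = 0 := by
      rw [← hv, he, ← map_mul, ← hchar (u * v * X)]
      exact congrArg _ (by ring)
    rw [mul_sub, mul_one, sub_eq_zero] at this
    exact this.symm
  have hidem' : IsIdempotentElem (Matrix.toLin' e) := by
    rw [IsIdempotentElem, Module.End.mul_eq_comp, ← Matrix.toLin'_mul, hidem.eq]
  have he0 : e = 0 := by
    have : Matrix.toLin' e = 0 := by
      refine LinearMap.IsIdempotentElem.eq_zero_of_trace_eq_zero hidem' ?_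
      rw [Matrix.trace_toLin'_eq, he, ← htr (u * X ^ a)]
      exact congrArg (fun w => (aeval A w).trace) (by ring)
    simpa using this
  refine ⟨a, ?_⟩
  rw [he0, sub_zero] at hv
  calc A ^ a = aeval A (X ^ a) * aeval A (v * r) := by simp [hv]
    _ = 0 := by
      rw [← map_mul, ← hchar v]
      exact congrArg _ (by ring)

/-- A square matrix over an integral domain of characteristic zero all of whose positive powers
have trace zero is nilpotent. -/
theorem Matrix.isNilpotent_of_forall_trace_pow_eq_zero {R ι : Type*} [CommRing R] [IsDomain R]
    [CharZero R] [Fintype ι] [DecidableEq ι] (A : Matrix ι ι R)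
    (h : ∀ m, 0 < m → (A ^ m).trace = 0) : IsNilpotent A := by
  have hinj := IsFractionRing.injective R (FractionRing R)
  have : CharZero (FractionRing R) := charZero_of_injective_algebraMap hinj
  have hinj' : Function.Injective ((algebraMap R (FractionRing R)).mapMatrix (m := ι)) :=
    Matrix.map_injective hinj
  rw [← IsNilpotent.map_iff hinj']
  refine Matrix.isNilpotent_of_forall_trace_pow_eq_zero_of_field _ fun m hm => ?_
  rw [← map_pow, RingHom.mapMatrix_apply, ← AddMonoidHom.map_trace, h m hm, map_zero]

section Homogenization

open Polynomial

variable {n : ℕ}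

/-- The homogenization of `p` in degree `d`, as a polynomial in the new variable. -/
noncomputable def homogenization (d : ℕ) (p : MvPolynomial (Fin n) ℝ) :
    (MvPolynomial (Fin n) ℝ)[X] :=
  X ^ d + ∑ j ∈ Finset.range d, C (MvPolynomial.homogeneousComponent (d - j) p) * X ^ j

theorem degree_homogenization_sum_lt (d : ℕ) (p : MvPolynomial (Fin n) ℝ) :
    (∑ j ∈ Finset.range d,
      C (MvPolynomial.homogeneousComponent (d - j) p) * X ^ j).degree < (d : WithBot ℕ) := by
  refine (degree_sum_le _ _).trans_lt ((Finset.sup_lt_iff (WithBot.bot_lt_coe d)).2 ?_)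
  intro j hj
  exact (degree_C_mul_X_pow_le _ _).trans_lt (Nat.cast_lt.2 (Finset.mem_range.1 hj))

theorem homogenization_monic (d : ℕ) (p : MvPolynomial (Fin n) ℝ) : (homogenization d p).Monic :=
  monic_X_pow_add (degree_homogenization_sum_lt d p)

theorem degree_homogenization (d : ℕ) (p : MvPolynomial (Fin n) ℝ) :
    (homogenization d p).degree = d := by
  rw [homogenization, degree_add_eq_left_of_degree_lt, degree_X_pow]
  rw [degree_X_pow]
  exact degree_homogenization_sum_lt d p

/-- The ring endomorphism of `ℝ[x₁,…,xₙ][t]` sending `xᵢ` to `xᵢ t` and fixing `t`. -/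
noncomputable def scaleVars (n : ℕ) :
    (MvPolynomial (Fin n) ℝ)[X] →+* (MvPolynomial (Fin n) ℝ)[X] :=
  eval₂RingHom (MvPolynomial.aeval (R := ℝ) fun i => C (MvPolynomial.X i) * X).toRingHom X

theorem scaleVars_X : scaleVars n X = X := by simp [scaleVars]

theorem scaleVars_C (q : MvPolynomial (Fin n) ℝ) :
    scaleVars n (C q) = MvPolynomial.aeval (R := ℝ) (fun i => C (MvPolynomial.X i) * X) q := by
  simp [scaleVars]

theorem scaleVars_C_of_isHomogeneous {q : MvPolynomial (Fin n) ℝ} {i : ℕ}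
    (hq : q.IsHomogeneous i) : scaleVars n (C q) = C q * X ^ i := by
  rw [scaleVars_C]
  conv_rhs => rw [q.as_sum]
  conv_lhs => rw [q.as_sum]
  rw [map_sum, map_sum, Finset.sum_mul]
  refine Finset.sum_congr rfl fun m hm => ?_
  have hdeg : m.degree = i := (Finsupp.degree_eq_weight_one (R := ℕ) ▸ hq (MvPolynomial.mem_support_iff.1 hm))
  rw [MvPolynomial.aeval_monomial, MvPolynomial.monomial_eq, map_mul, mul_assoc]
  congr 1
  simp only [Finsupp.prod, mul_pow, Finset.prod_mul_distrib, map_prod, map_pow]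
  rw [Finset.prod_pow_eq_pow_sum, ← hdeg]
  rfl

theorem scaleVars_injective : Function.Injective (scaleVars n) := by
  let F := FractionRing (MvPolynomial (Fin n) ℝ)[X]
  let ι : (MvPolynomial (Fin n) ℝ)[X] →+* F := algebraMap _ F
  have hι : Function.Injective ι := IsFractionRing.injective _ _
  have hX : ι X ≠ 0 := (map_ne_zero_iff ι hι).2 X_ne_zero
  let ρ : (MvPolynomial (Fin n) ℝ)[X] →+* F :=
    eval₂RingHom (MvPolynomial.eval₂Hom (ι.comp (C.comp MvPolynomial.C))
      fun i => ι (C (MvPolynomial.X i)) / ι X) (ι X)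
  have hcomp : ρ.comp (scaleVars n) = ι := by
    refine Polynomial.ringHom_ext' (MvPolynomial.ringHom_ext (fun c => ?_) fun i => ?_) ?_
    · have : scaleVars n (C (MvPolynomial.C c)) = C (MvPolynomial.C c) := by
        simpa using scaleVars_C_of_isHomogeneous (MvPolynomial.isHomogeneous_C (Fin n) c)
      simp [this, ρ]
    · have : scaleVars n (C (MvPolynomial.X i)) = C (MvPolynomial.X i) * X := by
        simpa using scaleVars_C_of_isHomogeneous (MvPolynomial.isHomogeneous_X ℝ i)
      simpa [this, ρ] using div_mul_cancel₀ _ hX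
    · simp [scaleVars_X, ρ]
  refine Function.Injective.of_comp (f := ρ) ?_
  rw [← RingHom.coe_comp, hcomp]
  exact hι

theorem scaleVars_homogenization {p : MvPolynomial (Fin n) ℝ}
    (hp : MvPolynomial.constantCoeff p = 1) :
    scaleVars n (homogenization p.totalDegree p) = X ^ p.totalDegree * C p := by
  have hsum := MvPolynomial.sum_homogeneousComponent p
  rw [Finset.sum_range_succ', MvPolynomial.homogeneousComponent_zero,
    ← MvPolynomial.constantCoeff_eq, hp, MvPolynomial.C_1] at hsum
  rw [← congrArg C hsum, homogenization, map_add, map_pow, scaleVars_X, map_sum, map_add, map_sum, map_one,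
    mul_add, mul_one, add_comm, Finset.mul_sum, ← Finset.sum_range_reflect]
  congr 1
  refine Finset.sum_congr rfl fun j hj => ?_
  have hj := Finset.mem_range.1 hj
  rw [map_mul, scaleVars_C_of_isHomogeneous (MvPolynomial.homogeneousComponent_isHomogeneous _ _),
    map_pow, scaleVars_X, show p.totalDegree - (p.totalDegree - 1 - j) = j + 1 by omega, mul_assoc,
    ← pow_add, show j + 1 + (p.totalDegree - 1 - j) = p.totalDegree by omega, mul_comm]

theorem homogeneousComponent_totalDegree_ne_zero {p : MvPolynomial (Fin n) ℝ} (hp : p ≠ 0) :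
    MvPolynomial.homogeneousComponent p.totalDegree p ≠ 0 := by
  obtain ⟨m, hm, hmax⟩ := Finset.exists_mem_eq_sup p.support
    (MvPolynomial.support_nonempty.2 hp) fun s => s.sum fun _ e => e
  intro h
  have := congrArg (MvPolynomial.coeff m) h
  rw [MvPolynomial.coeff_homogeneousComponent, if_pos (by exact hmax.symm)] at this
  exact MvPolynomial.mem_support_iff.1 hm this

theorem squarefree_homogenization {p : MvPolynomial (Fin n) ℝ}
    (hp : MvPolynomial.constantCoeff p = 1) (hsf : Squarefree p) :
    Squarefree (homogenization p.totalDegree p) := by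
  have hp0 : p ≠ 0 := hsf.ne_zero
  rintro A ⟨B, hB⟩
  have hA0 : A ≠ 0 := by
    rintro rfl
    exact (homogenization_monic p.totalDegree p).ne_zero (by simpa using hB)
  have hσA : scaleVars n A ≠ 0 := (map_ne_zero_iff _ scaleVars_injective).2 hA0
  obtain ⟨U, hU, hXU⟩ := exists_eq_pow_rootMultiplicity_mul_and_not_dvd _ hσA 0
  rw [C_0, sub_zero] at hU hXU
  set e := (scaleVars n A).rootMultiplicity 0
  have hσ : X ^ p.totalDegree * C p = U * U * (X ^ e * X ^ e * scaleVars n B) := by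
    rw [← scaleVars_homogenization hp, hB, map_mul, map_mul, hU]
    ring
  obtain ⟨W, hW⟩ : X ^ p.totalDegree ∣ X ^ e * X ^ e * scaleVars n B :=
    prime_X.pow_dvd_of_dvd_mul_left _ (fun h => (prime_X.dvd_or_dvd h).elim hXU hXU) ⟨_, hσ.symm⟩
  have hCp : C p = U * U * W := by
    refine mul_left_cancel₀ (pow_ne_zero p.totalDegree X_ne_zero) ?_
    rw [hσ, hW]
    ring
  have hUU : U * U ∣ C p := ⟨W, hCp⟩
  have hUdeg : U.natDegree = 0 := by
    have := natDegree_le_of_dvd ((dvd_mul_right U U).trans hUU) (C_ne_zero.2 hp0)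
    rwa [natDegree_C, Nat.le_zero] at this
  obtain ⟨u, rfl⟩ := natDegree_eq_zero.1 hUdeg
  have hu : IsUnit u := hsf u (by
    rw [← C_mul, C_dvd_iff_dvd_coeff] at hUU
    simpa using hUU 0)
  obtain ⟨c, hc, rfl⟩ := MvPolynomial.isUnit_iff_eq_C_of_isReduced.1 hu
  have hA : A = X ^ e * C (MvPolynomial.C c) := by
    apply scaleVars_injective
    rw [hU, map_mul, map_pow, scaleVars_X,
      scaleVars_C_of_isHomogeneous (MvPolynomial.isHomogeneous_C (Fin n) c), pow_zero, mul_one]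
  have he : e = 0 := by
    by_contra he
    have hX : X ∣ homogenization p.totalDegree p := by
      rw [hB, hA]
      exact (((dvd_pow_self X he).mul_right _).mul_right _).mul_right _
    have hne := homogeneousComponent_totalDegree_ne_zero hp0
    rw [X_dvd_iff, homogenization, coeff_add, finsetSum_coeff] at hX
    rcases Nat.eq_zero_or_pos p.totalDegree with h0 | h0
    · simp [h0] at hX
    · simp [coeff_X_pow, h0.ne, hne, h0.ne'] at hX
  rw [hA, he, pow_zero, one_mul]
  exact hu.map C

end Homogenization

section Companion

open Polynomial

variable {n d : ℕ}

theorem companionM_mulVec_single (p : MvPolynomial (Fin n) ℝ) {i : ℕ} (hi : i + 1 < d) :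
    companionM d p *ᵥ Pi.single ⟨i, by omega⟩ 1 = Pi.single ⟨i + 1, hi⟩ 1 := by
  ext1 j
  rw [mulVec_single_one]
  simp only [col_apply, companionM, Pi.single_apply, Fin.ext_iff]
  rw [if_neg (by omega)]

theorem companionM_pow_mulVec_single (p : MvPolynomial (Fin n) ℝ) {i : ℕ} (hi : i < d) :
    companionM d p ^ i *ᵥ Pi.single ⟨0, by omega⟩ 1 = Pi.single ⟨i, hi⟩ 1 := by
  induction i with
  | zero => rw [pow_zero, one_mulVec]
  | succ i ih =>
    rw [pow_succ', ← mulVec_mulVec, ih (by omega), companionM_mulVec_single p hi]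

theorem aeval_companionM_mulVec_single (p : MvPolynomial (Fin n) ℝ) (hd : 0 < d)
    {r : (MvPolynomial (Fin n) ℝ)[X]} (hr : r.degree < d) :
    aeval (companionM d p) r *ᵥ Pi.single ⟨0, hd⟩ 1 = fun i : Fin d => r.coeff i := by
  rw [aeval_eq_sum_range' (n := d) (by
    rcases eq_or_ne r 0 with rfl | h0
    · simpa using hd
    · exact (natDegree_lt_iff_degree_lt h0).2 hr), ← Fin.sum_univ_eq_sum_range
      (fun i => r.coeff i • companionM d p ^ i), sum_mulVec]
  simp_rw [smul_mulVec, companionM_pow_mulVec_single p (Fin.is_lt _)]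
  ext1 j
  simp [Finset.sum_apply, Pi.single_apply]

theorem aeval_companionM_homogenization (p : MvPolynomial (Fin n) ℝ) (hd : 0 < d) :
    aeval (companionM d p) (homogenization d p) = 0 := by
  have h0 : aeval (companionM d p) (homogenization d p) *ᵥ Pi.single ⟨0, hd⟩ 1 = 0 := by
    rw [homogenization, map_add, add_mulVec,
      aeval_companionM_mulVec_single p hd (degree_homogenization_sum_lt d p), map_pow, aeval_X]
    obtain ⟨m, rfl⟩ : ∃ m, d = m + 1 := ⟨d - 1, by omega⟩
    rw [pow_succ', ← mulVec_mulVec, companionM_pow_mulVec_single p (Nat.lt_succ_self m),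
      mulVec_single_one]
    ext1 i
    have hi : (i : ℕ) ≤ m := Nat.lt_succ_iff.1 i.2
    simp [companionM, finsetSum_coeff, coeff_X_pow, hi]
  refine Matrix.ext_of_mulVec_single fun i => ?_
  rw [← companionM_pow_mulVec_single p i.2, mulVec_mulVec, zero_mulVec,
    show companionM d p ^ (i : ℕ) = aeval (companionM d p)
      (X ^ (i : ℕ) : (MvPolynomial (Fin n) ℝ)[X]) by simp,
    ← map_mul, mul_comm, map_mul, ← mulVec_mulVec, h0, mulVec_zero]

theorem homogenization_dvd_of_aeval_eq_zero (p : MvPolynomial (Fin n) ℝ) (hd : 0 < d)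
    {g : (MvPolynomial (Fin n) ℝ)[X]} (hg : aeval (companionM d p) g = 0) :
    homogenization d p ∣ g := by
  have hmonic := homogenization_monic d p
  rw [← modByMonic_eq_zero_iff_dvd hmonic]
  have hdeg := degree_modByMonic_lt g hmonic
  rw [degree_homogenization] at hdeg
  have hcoeff := aeval_companionM_mulVec_single p hd hdeg
  rw [aeval_modByMonic_eq_self_of_root (aeval_companionM_homogenization p hd), hg,
    zero_mulVec] at hcoeff
  ext1 i
  by_cases hi : i < d
  · exact (congrFun hcoeff ⟨i, hi⟩).symm
  · exact coeff_eq_zero_of_degree_lt (hdeg.trans_le (by exact_mod_cast not_lt.1 hi))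

theorem trace_aeval_companionM_eq_zero (p : MvPolynomial (Fin n) ℝ) (hd : 0 < d)
    {f : Fin d → MvPolynomial (Fin n) ℝ} (hf : hermiteM d p *ᵥ f = 0)
    (h : (MvPolynomial (Fin n) ℝ)[X]) :
    (aeval (companionM d p) (h * ∑ j, C (f j) * X ^ (j : ℕ))).trace = 0 := by
  have hmonic := homogenization_monic d p
  have hdeg := degree_modByMonic_lt h hmonic
  rw [degree_homogenization] at hdeg
  rw [map_mul, ← aeval_modByMonic_eq_self_of_root (aeval_companionM_homogenization p hd),
    aeval_eq_sum_range' (n := d) (by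
      rcases eq_or_ne (h %ₘ homogenization d p) 0 with h0 | h0
      · simpa [h0] using hd
      · exact (natDegree_lt_iff_degree_lt h0).2 hdeg), Finset.sum_mul, trace_sum]
  refine Finset.sum_eq_zero fun i hi => ?_
  rw [smul_mul_assoc, trace_smul]
  have := congrFun hf ⟨i, Finset.mem_range.1 hi⟩
  simp only [mulVec, dotProduct, hermiteM, Pi.zero_apply] at this
  convert! smul_zero _
  rw [← this, map_sum, Finset.mul_sum, trace_sum]
  refine Finset.sum_congr rfl fun j _ => ?_
  rw [map_mul, map_pow, aeval_X, aeval_C, ← Algebra.smul_def, mul_smul_comm, trace_smul, ← pow_add,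
    smul_eq_mul, mul_comm]

theorem eq_zero_of_hermiteM_mulVec_eq_zero {p : MvPolynomial (Fin n) ℝ}
    (hp : MvPolynomial.constantCoeff p = 1) (hsf : Squarefree p)
    {f : Fin p.totalDegree → MvPolynomial (Fin n) ℝ}
    (hf : hermiteM p.totalDegree p *ᵥ f = 0) : f = 0 := by
  ext1 i
  have hd : 0 < p.totalDegree := i.pos
  set g : (MvPolynomial (Fin n) ℝ)[X] := ∑ j, C (f j) * X ^ (j : ℕ) with hg
  obtain ⟨m, hm⟩ : IsNilpotent (aeval (companionM p.totalDegree p) g) := by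
    refine Matrix.isNilpotent_of_forall_trace_pow_eq_zero _ fun m hm => ?_
    obtain ⟨m, rfl⟩ : ∃ l, m = l + 1 := ⟨m - 1, by omega⟩
    rw [← map_pow, pow_succ, hg]
    exact trace_aeval_companionM_eq_zero p hd hf _
  rw [← map_pow] at hm
  have hdvd : homogenization p.totalDegree p ∣ g :=
    (squarefree_homogenization hp hsf).isRadical m g (homogenization_dvd_of_aeval_eq_zero p hd hm)
  have hg0 : g = 0 := by
    refine eq_zero_of_dvd_of_degree_lt hdvd ?_
    rw [degree_homogenization]
    refine (degree_sum_le _ _).trans_lt ((Finset.sup_lt_iff (WithBot.bot_lt_coe _)).2 ?_)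
    intro j _
    exact (degree_C_mul_X_pow_le _ _).trans_lt (by exact_mod_cast j.2)
  have := congrArg (fun q => coeff q i) hg0
  simpa [hg, finsetSum_coeff, coeff_X_pow, Fin.val_inj] using this

end Companion

/-- Let `p` be a square-free real-zero polynomial of degree `d`, `q ≠ 0`, and suppose
`q² · 𝓗(p) = 𝓠ᵀ𝓠` for a `k × d` polynomial matrix `𝓠`. Then the linear map `f ↦ 𝓠f` is
injective. -/
theorem sos_factor_injective {n : ℕ} (p : MvPolynomial (Fin n) ℝ) (d : ℕ)
    (hRZ : IsRealZero p) (hsf : Squarefree p) (hdeg : p.totalDegree = d)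
    (q : MvPolynomial (Fin n) ℝ) (hq : q ≠ 0) (k : ℕ)
    (Q : Matrix (Fin k) (Fin d) (MvPolynomial (Fin n) ℝ))
    (hQ : q ^ 2 • hermiteM d p = Qᵀ * Q) :
    ∀ f : Fin d → MvPolynomial (Fin n) ℝ, Q.mulVec f = 0 → f = 0 := by
  intro f hf
  subst hdeg
  refine eq_zero_of_hermiteM_mulVec_eq_zero hRZ.1 hsf ?_
  have h : q ^ 2 • (hermiteM p.totalDegree p *ᵥ f) = 0 := by
    rw [← smul_mulVec, hQ, ← mulVec_mulVec, hf, mulVec_zero]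
  exact (smul_eq_zero.1 h).resolve_left (pow_ne_zero 2 hq)
end

section
/- Let p ∈ ℝ[x₁,…,xₙ] be a square-free real-zero polynomial of degree d with p(0) = 1. Suppose q ∈ ℝ[x₁,…,xₙ] is a nonzero homogeneous polynomial and q² · 𝓗(p) = 𝓠ᵀ𝓠 for a k×d matrix 𝓠 with polynomial entries. If there exists a symmetric linear matrix polynomial 𝓜 = x₁M₁ + ⋯ + xₙMₙ of size k (with M₁,…,Mₙ real symmetric k×k matrices) such that 𝓜 · 𝓠 = 𝓠 · L_t, then p divides det(I − 𝓜) in ℝ[x₁,…,xₙ]. -/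
open Matrix

/-- The monic polynomial `X ^ d + ∑ i, c i X ^ i` with prescribed lower coefficients. -/
noncomputable def monicOfCoeffs {R : Type*} [CommRing R] {d : ℕ} (c : Fin d → R) :
    Polynomial R :=
  Polynomial.X ^ d + ∑ i : Fin d, Polynomial.C (c i) * Polynomial.X ^ (i : ℕ)

/-- The companion matrix of `monicOfCoeffs c`. -/
def companionOfCoeffs {R : Type*} [CommRing R] {d : ℕ} (c : Fin d → R) :
    Matrix (Fin d) (Fin d) R := fun i j =>
  if (j : ℕ) = d - 1 then -c i else if (i : ℕ) = (j : ℕ) + 1 then 1 else 0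

section Companion

variable {R : Type*} [CommRing R] {d : ℕ}

theorem degree_sum_coeffs_lt (c : Fin d → R) :
    (∑ i : Fin d, Polynomial.C (c i) * Polynomial.X ^ (i : ℕ)).degree < (d : WithBot ℕ) := by
  rw [Polynomial.degree_lt_iff_coeff_zero]
  intro m hm
  rw [Polynomial.finsetSum_coeff]
  refine Finset.sum_eq_zero fun i _ => ?_
  rw [Polynomial.coeff_C_mul_X_pow, if_neg (by omega)]

theorem monic_monicOfCoeffs (c : Fin d → R) : (monicOfCoeffs c).Monic :=
  Polynomial.monic_X_pow_add (degree_sum_coeffs_lt c)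

theorem natDegree_monicOfCoeffs [Nontrivial R] (c : Fin d → R) :
    (monicOfCoeffs c).natDegree = d := by
  have := degree_sum_coeffs_lt c
  rw [monicOfCoeffs]
  apply Polynomial.natDegree_eq_of_degree_eq_some
  rw [Polynomial.degree_add_eq_left_of_degree_lt, Polynomial.degree_X_pow]
  rwa [Polynomial.degree_X_pow]

theorem map_monicOfCoeffs {S : Type*} [CommRing S] (φ : R →+* S) (c : Fin d → R) :
    (monicOfCoeffs c).map φ = monicOfCoeffs (φ ∘ c) := by
  simp [monicOfCoeffs, Polynomial.map_sum]

theorem map_companionOfCoeffs {S : Type*} [CommRing S] (φ : R →+* S) (c : Fin d → R) :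
    φ.mapMatrix (companionOfCoeffs c) = companionOfCoeffs (φ ∘ c) := by
  ext i j
  simp only [RingHom.mapMatrix_apply, Matrix.map_apply, companionOfCoeffs, Function.comp]
  split_ifs <;> simp

theorem eval_monicOfCoeffs (c : Fin d → R) (x : R) :
    (monicOfCoeffs c).eval x = x ^ d + ∑ i, c i * x ^ (i : ℕ) := by
  simp [monicOfCoeffs, Polynomial.eval_finsetSum]

theorem vandermonde_mul_companionOfCoeffs (c : Fin d → R) (v : Fin d → R)
    (hv : ∀ i, (monicOfCoeffs c).IsRoot (v i)) :
    vandermonde v * companionOfCoeffs c = diagonal v * vandermonde v := by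
  ext i j
  rw [Matrix.diagonal_mul, Matrix.mul_apply]
  simp only [vandermonde_apply, companionOfCoeffs]
  by_cases hj : (j : ℕ) = d - 1
  · have h := hv i
    rw [Polynomial.IsRoot, eval_monicOfCoeffs] at h
    have hd : (j : ℕ) + 1 = d := by omega
    simp only [hj, if_true, mul_neg, Finset.sum_neg_distrib]
    rw [← hj, ← pow_succ', hd, ← add_eq_zero_iff_neg_eq, add_comm]
    simp only [← h, mul_comm]
  · have hlt : (j : ℕ) + 1 < d := by omega
    rw [Finset.sum_eq_single ⟨j + 1, hlt⟩]
    · simp [hj, pow_succ']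
    · intro b _ hb
      have : ¬ (b : ℕ) = j + 1 := fun h => hb (Fin.ext h)
      simp [hj, this]
    · simp

end Companion

section Field

variable {F : Type*} [Field F] {d k : ℕ}

theorem isUnit_det_vandermonde {v : Fin d → F} (hinj : Function.Injective v) :
    IsUnit (vandermonde v).det :=
  isUnit_iff_ne_zero.mpr (det_vandermonde_ne_zero_iff.mpr hinj)

theorem companionOfCoeffs_eq_conj (c v : Fin d → F) (hinj : Function.Injective v)
    (hv : ∀ i, (monicOfCoeffs c).IsRoot (v i)) :
    companionOfCoeffs c = (vandermonde v)⁻¹ * diagonal v * vandermonde v := by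
  rw [Matrix.mul_assoc, ← vandermonde_mul_companionOfCoeffs c v hv,
    nonsing_inv_mul_cancel_left _ _ (isUnit_det_vandermonde hinj)]

theorem trace_companionOfCoeffs_pow (c v : Fin d → F) (hinj : Function.Injective v)
    (hv : ∀ i, (monicOfCoeffs c).IsRoot (v i)) (m : ℕ) :
    (companionOfCoeffs c ^ m).trace = ∑ i, v i ^ m := by
  have hV := isUnit_det_vandermonde hinj
  have hpow : vandermonde v * companionOfCoeffs c ^ m = diagonal v ^ m * vandermonde v :=
    (show SemiconjBy (vandermonde v) (companionOfCoeffs c) (diagonal v) from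
      vandermonde_mul_companionOfCoeffs c v hv).pow_right m
  have : companionOfCoeffs c ^ m = (vandermonde v)⁻¹ * (diagonal v ^ m * vandermonde v) := by
    rw [← hpow, nonsing_inv_mul_cancel_left _ _ hV]
  rw [this, Matrix.trace_mul_comm, Matrix.mul_assoc, mul_nonsing_inv _ hV, Matrix.mul_one,
    diagonal_pow, trace_diagonal]
  rfl

/-- If `Q` intertwines the companion matrix with `M`, and `Qᵀ Q` is a nonzero multiple of the
Hermite matrix, then the (pairwise distinct) eigenvalues of the companion matrix are
eigenvalues of `M`. -/
theorem isRoot_charpoly_of_intertwining (c v : Fin d → F) (hinj : Function.Injective v)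
    (hv : ∀ i, (monicOfCoeffs c).IsRoot (v i)) {q : F} (hq : q ≠ 0)
    (Q : Matrix (Fin k) (Fin d) F)
    (hQ : ∀ i j : Fin d, q * (companionOfCoeffs c ^ ((i : ℕ) + j)).trace = (Qᵀ * Q) i j)
    (M : Matrix (Fin k) (Fin k) F) (hM : M * Q = Q * companionOfCoeffs c) (i : Fin d) :
    M.charpoly.IsRoot (v i) := by
  have hV := isUnit_det_vandermonde hinj
  have hQQ : Qᵀ * Q = q • ((vandermonde v)ᵀ * vandermonde v) := by
    ext a b
    rw [← hQ, trace_companionOfCoeffs_pow c v hinj hv, Matrix.smul_apply,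
      vandermonde_transpose_mul_vandermonde, smul_eq_mul]
  set W := Q * (vandermonde v)⁻¹ with hW
  have hMW : M * W = W * diagonal v := by
    rw [hW, ← Matrix.mul_assoc, hM, companionOfCoeffs_eq_conj c v hinj hv]
    simp only [Matrix.mul_assoc, mul_nonsing_inv _ hV, Matrix.mul_one]
  have hWW : Qᵀ * W = q • (vandermonde v)ᵀ := by
    rw [hW, ← Matrix.mul_assoc, hQQ, Matrix.smul_mul, Matrix.mul_assoc, mul_nonsing_inv _ hV,
      Matrix.mul_one]
  rw [Polynomial.IsRoot, Matrix.eval_charpoly, ← Matrix.exists_mulVec_eq_zero_iff]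
  refine ⟨W *ᵥ Pi.single i 1, fun h0 => ?_, ?_⟩
  · have h := congrArg (fun u => (Qᵀ *ᵥ u) ⟨0, i.pos⟩) h0
    simp only [mulVec_mulVec, hWW, mulVec_zero] at h
    simp [vandermonde_apply, hq] at h
  · rw [Matrix.sub_mulVec, mulVec_mulVec _ M, hMW, ← mulVec_mulVec _ W, diagonal_mulVec_single, mul_one]
    have : (Pi.single i (v i) : Fin d → F) = v i • Pi.single i 1 := by
      rw [← Pi.single_smul, smul_eq_mul, mul_one]
    rw [this, mulVec_smul, Matrix.scalar_apply, ← Matrix.smul_one_eq_diagonal, Matrix.smul_mulVec,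
      Matrix.one_mulVec, sub_self]

end Field

section Descent

open Polynomial

variable {R : Type*} [CommRing R] {d k : ℕ}

/-- Over an integrally closed domain of characteristic zero, a monic polynomial having no
nontrivial square factor becomes separable over the fraction field. -/
theorem separable_map_of_sq_dvd [IsIntegrallyClosed R] [CharZero R] {K : Type*} [Field K]
    [Algebra R K] [IsFractionRing R K] {f : R[X]} (hf : f.Monic)
    (hsq : ∀ g : R[X], g.Monic → g * g ∣ f → g = 1) :
    (f.map (algebraMap R K)).Separable := by
  have : CharZero K := charZero_of_injective_algebraMap (IsFractionRing.injective R K)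
  rw [PerfectField.separable_iff_squarefree]
  intro g hg
  have hg0 : g ≠ 0 := by
    rintro rfl
    exact (hf.map (algebraMap R K)).ne_zero (by simpa using hg)
  obtain ⟨g', hg'⟩ := IsIntegrallyClosed.eq_map_mul_C_of_dvd K hf
    ((dvd_mul_right g g).trans hg)
  have hu : IsUnit (C g.leadingCoeff) := by simpa using hg0
  have hmon : g'.Monic := by
    apply Polynomial.monic_of_injective (IsFractionRing.injective R K)
    have := congrArg leadingCoeff hg'
    rw [leadingCoeff_mul, leadingCoeff_C] at this
    exact mul_right_cancel₀ (leadingCoeff_ne_zero.mpr hg0) (by rw [this, one_mul])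
  have hdvd : g' * g' ∣ f := by
    rw [← Polynomial.map_dvd_map _ (IsFractionRing.injective R K) (hmon.mul hmon),
      Polynomial.map_mul]
    refine (mul_dvd_mul ?_ ?_).trans hg <;> exact ⟨_, hg'.symm⟩
  rw [← hg', hsq g' hmon hdvd, Polynomial.map_one, one_mul]
  exact hu

theorem monicOfCoeffs_dvd_charpoly_of_intertwining [IsDomain R] [IsIntegrallyClosed R]
    [CharZero R] (c : Fin d → R) (hsq : ∀ g : R[X], g.Monic → g * g ∣ monicOfCoeffs c → g = 1)
    {q : R} (hq : q ≠ 0) (Q : Matrix (Fin k) (Fin d) R)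
    (hQ : ∀ i j : Fin d, q * (companionOfCoeffs c ^ ((i : ℕ) + j)).trace = (Qᵀ * Q) i j)
    (M : Matrix (Fin k) (Fin k) R) (hM : M * Q = Q * companionOfCoeffs c) :
    monicOfCoeffs c ∣ M.charpoly := by
  classical
  let K := FractionRing R
  let F := AlgebraicClosure K
  let φ : R →+* F := (algebraMap K F).comp (algebraMap R K)
  have hφ : Function.Injective φ :=
    (algebraMap K F).injective.comp (IsFractionRing.injective R K)
  have hsep : ((monicOfCoeffs c).map φ).Separable := by
    rw [← Polynomial.map_map]
    exact (separable_map_of_sq_dvd (monic_monicOfCoeffs c) hsq).map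
  rw [← Polynomial.map_dvd_map φ hφ (monic_monicOfCoeffs c)]
  rw [map_monicOfCoeffs] at hsep ⊢
  rw [← Matrix.charpoly_map]
  set P := monicOfCoeffs (φ ∘ c) with hP
  have hsplit : P.Splits := IsAlgClosed.splits P
  have hnodup := nodup_roots hsep
  have hcard : P.roots.toFinset.card = d := by
    rw [Multiset.toFinset_card_of_nodup hnodup, ← hsplit.natDegree_eq_card_roots,
      natDegree_monicOfCoeffs]
  let e := P.roots.toFinset.equivFinOfCardEq hcard
  let v : Fin d → F := fun i => e.symm i
  have hinj : Function.Injective v := Subtype.val_injective.comp e.symm.injective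
  have hv : ∀ i, P.IsRoot (v i) := fun i =>
    isRoot_of_mem_roots (Multiset.mem_toFinset.mp (e.symm i).2)
  rw [hsplit.eq_prod_roots_of_monic (monic_monicOfCoeffs _),
    Multiset.prod_X_sub_C_dvd_iff_le_roots (Matrix.charpoly_monic _).ne_zero,
    Multiset.le_iff_subset hnodup]
  intro x hx
  rw [mem_roots (Matrix.charpoly_monic _).ne_zero]
  have hx' : v (e ⟨x, Multiset.mem_toFinset.mpr hx⟩) = x := by simp [v]
  rw [← hx']
  refine isRoot_charpoly_of_intertwining (φ ∘ c) v hinj hv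
    ((map_ne_zero_iff φ hφ).mpr hq) (Q.map φ) (fun i j => ?_) _ ?_ _
  · rw [← map_companionOfCoeffs, ← map_pow, RingHom.mapMatrix_apply, ← AddMonoidHom.map_trace,
      ← map_mul, hQ, ← transpose_map, ← Matrix.map_mul, Matrix.map_apply]
  · rw [← map_companionOfCoeffs, RingHom.mapMatrix_apply, ← Matrix.map_mul, ← Matrix.map_mul, hM]

end Descent

namespace MvPolynomial

variable {n : ℕ}

/-- The coefficients (as a polynomial in `t`) of the homogenization of `p`, below degree `d`. -/
noncomputable def homogenizationCoeffs (d : ℕ) (p : MvPolynomial (Fin n) ℝ) :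
    Fin d → MvPolynomial (Fin n) ℝ :=
  fun i => homogeneousComponent (d - (i : ℕ)) p

theorem eval_one_monicOfCoeffs_homogenizationCoeffs {d : ℕ} {p : MvPolynomial (Fin n) ℝ}
    (hp : constantCoeff p = 1) (hd : p.totalDegree = d) :
    (monicOfCoeffs (homogenizationCoeffs d p)).eval 1 = p := by
  rw [eval_monicOfCoeffs]
  simp only [one_pow, mul_one, homogenizationCoeffs]
  conv_rhs => rw [← sum_homogeneousComponent p, hd, Finset.sum_range_succ']
  rw [homogeneousComponent_zero, ← constantCoeff_eq, hp, C_1, add_comm,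
    Fin.sum_univ_eq_sum_range (fun i => homogeneousComponent (d - i) p),
    ← Finset.sum_range_reflect]
  congr 1
  refine Finset.sum_congr rfl fun i hi => ?_
  rw [Finset.mem_range] at hi
  congr 2
  omega

theorem totalDegree_eval_one_optionEquivLeft_le (f : MvPolynomial (Option (Fin n)) ℝ) :
    ((optionEquivLeft ℝ (Fin n) f).eval 1).totalDegree ≤ f.totalDegree := by
  rw [Polynomial.eval_eq_sum_range]
  refine totalDegree_finsetSum_le fun i _ => ?_
  simpa using totalDegree_coeff_optionEquivLeft_le ℝ (Fin n) f i

theorem natDegree_optionEquivLeft_le_totalDegree {f : MvPolynomial (Option (Fin n)) ℝ} :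
    (optionEquivLeft ℝ (Fin n) f).natDegree ≤ f.totalDegree := by
  rw [natDegree_optionEquivLeft]
  exact degreeOf_le_totalDegree f none

theorem totalDegree_symm_monicOfCoeffs_le (d : ℕ) (p : MvPolynomial (Fin n) ℝ) :
    ((optionEquivLeft ℝ (Fin n)).symm
      (monicOfCoeffs (homogenizationCoeffs d p))).totalDegree ≤ d := by
  have hC (a : MvPolynomial (Fin n) ℝ) :
      (optionEquivLeft ℝ (Fin n)).symm (Polynomial.C a) = rename some a := by
    simp [optionEquivLeft]
  simp only [monicOfCoeffs, map_add, map_sum, map_mul, map_pow, optionEquivLeft_symm_X, hC]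
  refine (totalDegree_add _ _).trans (max_le (by simp) ?_)
  refine totalDegree_finsetSum_le fun i _ => (totalDegree_mul _ _).trans ?_
  have h1 : (homogenizationCoeffs d p i).totalDegree ≤ d - i :=
    (homogeneousComponent_isHomogeneous _ _).totalDegree_le
  have h2 := (totalDegree_rename_le (some : Fin n → Option (Fin n))
    (homogenizationCoeffs d p i)).trans h1
  rw [totalDegree_X_pow]
  omega

/-- The homogenization of a square-free polynomial has no nontrivial monic square factor. -/
theorem eq_one_of_sq_dvd_homogenization {d : ℕ} {p : MvPolynomial (Fin n) ℝ}
    (hp : constantCoeff p = 1) (hd : p.totalDegree = d) (hsf : Squarefree p)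
    (g : Polynomial (MvPolynomial (Fin n) ℝ)) (hg : g.Monic)
    (hdvd : g * g ∣ monicOfCoeffs (homogenizationCoeffs d p)) : g = 1 := by
  obtain ⟨h, hh⟩ := hdvd
  set E := optionEquivLeft ℝ (Fin n)
  have hmon := monic_monicOfCoeffs (homogenizationCoeffs d p)
  have hhm : h.Monic := (hg.mul hg).of_mul_monic_left (hh ▸ hmon)
  have hev := eval_one_monicOfCoeffs_homogenizationCoeffs hp hd
  rw [hh, Polynomial.eval_mul, Polynomial.eval_mul] at hev
  have hu : IsUnit (g.eval 1) := hsf _ ⟨_, hev.symm⟩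
  have hnat : g.natDegree + g.natDegree + h.natDegree = d := by
    rw [← natDegree_monicOfCoeffs (homogenizationCoeffs d p), hh, (hg.mul hg).natDegree_mul hhm,
      hg.natDegree_mul hg]
  have htot : (E.symm g).totalDegree + (E.symm g).totalDegree + (E.symm h).totalDegree ≤ d := by
    have hle := totalDegree_symm_monicOfCoeffs_le d p
    have hg0 : E.symm g ≠ 0 := by simpa using hg.ne_zero
    have hh0 : E.symm h ≠ 0 := by simpa using hhm.ne_zero
    rwa [hh, map_mul, map_mul, totalDegree_mul_of_isDomain (mul_ne_zero hg0 hg0) hh0,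
      totalDegree_mul_of_isDomain hg0 hg0] at hle
  have hgdeg : g.natDegree ≤ (E.symm g).totalDegree := by
    simpa [E] using natDegree_optionEquivLeft_le_totalDegree (f := E.symm g)
  have hpdeg : d ≤ (E.symm h).totalDegree := by
    have h1 : (h.eval 1).totalDegree ≤ (E.symm h).totalDegree := by
      simpa [E] using totalDegree_eval_one_optionEquivLeft_le (E.symm h)
    have h2 : (g.eval 1).totalDegree = 0 := by
      obtain ⟨r, -, hr⟩ := isUnit_iff_eq_C_of_isReduced.mp hu
      rw [hr, totalDegree_C]
    have h3 := totalDegree_mul (g.eval 1 * g.eval 1) (h.eval 1)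
    have h4 := totalDegree_mul (g.eval 1) (g.eval 1)
    rw [hev, hd] at h3
    omega
  exact hg.natDegree_eq_zero.mp (by omega)

end MvPolynomial

/-- Let `p` be a square-free real-zero polynomial of degree `d` with `p(0) = 1`, let `q` be
a nonzero homogeneous polynomial with `q² · 𝓗(p) = 𝓠ᵀ𝓠` for a `k × d` polynomial matrix
`𝓠`. If there is a symmetric linear matrix polynomial `𝓜` of size `k` with
`𝓜 · 𝓠 = 𝓠 · L_t`, then `p` divides `det(I - 𝓜)`. -/
theorem dvd_det_of_intertwining {n : ℕ} (p : MvPolynomial (Fin n) ℝ) (d : ℕ)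
    (hRZ : IsRealZero p) (hsf : Squarefree p) (hdeg : p.totalDegree = d)
    (q : MvPolynomial (Fin n) ℝ) (hq0 : q ≠ 0) (r : ℕ) (hqh : q.IsHomogeneous r)
    (k : ℕ) (Q : Matrix (Fin k) (Fin d) (MvPolynomial (Fin n) ℝ))
    (hQ : q ^ 2 • hermiteM d p = Qᵀ * Q)
    (M : Fin n → Matrix (Fin k) (Fin k) ℝ) (hsymm : ∀ l, (M l).IsSymm)
    (hcomm : pencil M * Q = Q * companionM d p) :
    p ∣ Matrix.det (1 - pencil M) := by
  have hq : ∀ i j : Fin d, q ^ 2 *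
      (companionOfCoeffs (MvPolynomial.homogenizationCoeffs d p) ^ ((i : ℕ) + j)).trace =
        (Qᵀ * Q) i j := fun i j => by
    rw [← hQ]
    rfl
  have hdvd := monicOfCoeffs_dvd_charpoly_of_intertwining
    (MvPolynomial.homogenizationCoeffs d p)
    (MvPolynomial.eq_one_of_sq_dvd_homogenization hRZ.1 hdeg hsf) (pow_ne_zero 2 hq0) Q hq
    (pencil M) hcomm
  have h := Polynomial.eval_dvd (x := 1) hdvd
  rwa [MvPolynomial.eval_one_monicOfCoeffs_homogenizationCoeffs hRZ.1 hdeg, Matrix.eval_charpoly,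
    map_one] at h
end

section
/- Let p ∈ ℝ[x₁,…,xₙ] with p(0) = 1 and deg p = d. Then for all 1 ≤ i,j ≤ d, the (i,j)-entry of the parametrized Hermite matrix 𝓗(p) is a homogeneous polynomial of degree i + j − 2 (or the zero polynomial). -/
open Matrix

/-- A matrix of polynomials is graded of degree `k` with respect to weights `w` if its
`(i, j)`-entry is homogeneous of degree `w j + k - w i`, and zero when this is negative. -/
def IsGradedMatrix {σ R ι : Type*} [CommRing R] (w : ι → ℕ)
    (A : Matrix ι ι (MvPolynomial σ R)) (k : ℕ) : Prop :=
  ∀ i j, (∀ m, w j + k = w i + m → (A i j).IsHomogeneous m) ∧ (w j + k < w i → A i j = 0)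

namespace IsGradedMatrix

variable {σ R ι : Type*} [CommRing R] {w : ι → ℕ} {A B : Matrix ι ι (MvPolynomial σ R)}

theorem one [DecidableEq ι] : IsGradedMatrix w (1 : Matrix ι ι (MvPolynomial σ R)) 0 := by
  intro i j
  rcases eq_or_ne i j with rfl | hij
  · refine ⟨fun m hm => ?_, fun h => by omega⟩
    obtain rfl : m = 0 := by omega
    simpa using MvPolynomial.isHomogeneous_one σ R
  · simp [Matrix.one_apply_ne hij, MvPolynomial.isHomogeneous_zero]

theorem mul [Fintype ι] {a b : ℕ} (hA : IsGradedMatrix w A a) (hB : IsGradedMatrix w B b) :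
    IsGradedMatrix w (A * B) (a + b) := by
  intro i j
  simp only [Matrix.mul_apply]
  refine ⟨fun m hm => MvPolynomial.IsHomogeneous.sum _ _ _ fun l _ => ?_,
    fun h => Finset.sum_eq_zero fun l _ => ?_⟩
  · by_cases hil : w l + a < w i
    · simp [(hA i l).2 hil, MvPolynomial.isHomogeneous_zero]
    by_cases hlj : w j + b < w l
    · simp [(hB l j).2 hlj, MvPolynomial.isHomogeneous_zero]
    obtain ⟨c, hc⟩ := Nat.exists_eq_add_of_le (not_lt.mp hil)
    obtain ⟨e, he⟩ := Nat.exists_eq_add_of_le (not_lt.mp hlj)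
    obtain rfl : m = c + e := by omega
    exact ((hA i l).1 c hc).mul ((hB l j).1 e he)
  · by_cases hil : w l + a < w i
    · simp [(hA i l).2 hil]
    · simp [(hB l j).2 (by omega)]

theorem pow [Fintype ι] [DecidableEq ι] {a : ℕ} (hA : IsGradedMatrix w A a) (k : ℕ) :
    IsGradedMatrix w (A ^ k) (k * a) := by
  induction k with
  | zero => simpa using one
  | succ k ih => simpa only [pow_succ, Nat.succ_mul] using ih.mul hA

theorem isHomogeneous_trace [Fintype ι] {k : ℕ} (hA : IsGradedMatrix w A k) :
    A.trace.IsHomogeneous k :=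
  MvPolynomial.IsHomogeneous.sum _ _ _ fun i _ => (hA i i).1 k rfl

end IsGradedMatrix

theorem isGradedMatrix_companionM {n : ℕ} (d : ℕ) (p : MvPolynomial (Fin n) ℝ) :
    IsGradedMatrix (fun i : Fin d => (i : ℕ)) (companionM d p) 1 := by
  intro i j
  have hi := i.isLt
  unfold companionM
  beta_reduce
  split_ifs with hj hij
  · refine ⟨fun m hm => ?_, fun h => by omega⟩
    obtain rfl : m = d - i := by omega
    exact (MvPolynomial.homogeneousComponent_isHomogeneous _ p).neg
  · refine ⟨fun m hm => ?_, fun h => by omega⟩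
    obtain rfl : m = 0 := by omega
    exact MvPolynomial.isHomogeneous_one _ _
  · exact ⟨fun m _ => MvPolynomial.isHomogeneous_zero _ _ _, fun _ => rfl⟩

/-- For `p` with `p(0) = 1` and `deg p = d`, the `(i,j)`-entry (1-based) of the
parametrized Hermite matrix `𝓗(p)` is homogeneous of degree `i + j - 2` (or zero). -/
theorem hermite_entries_homogeneous {n : ℕ} (p : MvPolynomial (Fin n) ℝ) (d : ℕ)
    (h0 : MvPolynomial.constantCoeff p = 1) (hdeg : p.totalDegree = d) :
    ∀ i j : Fin d, (hermiteM d p i j).IsHomogeneous ((i : ℕ) + (j : ℕ)) := by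
  intro i j
  simpa [hermiteM] using
    ((isGradedMatrix_companionM d p).pow ((i : ℕ) + (j : ℕ))).isHomogeneous_trace
end

section
/- Let A be a real symmetric n×n matrix, b ∈ ℝⁿ, and let p = xᵀAx + bᵀx + 1 ∈ ℝ[x₁,…,xₙ]. Then p is a real-zero polynomial if and only if the matrix b·bᵀ − 4A is positive semidefinite. -/
open Matrix

/-- A real quadratic `q z² + s z + 1` has only real complex roots iff its discriminant is
nonnegative. -/
theorem forall_root_im_eq_zero_iff (q s : ℝ) :
    (∀ z : ℂ, (q : ℂ) * z ^ 2 + s * z + 1 = 0 → z.im = 0) ↔ 0 ≤ s ^ 2 - 4 * q := by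
  constructor
  · intro h
    by_contra! hlt
    have hq : 0 < q := by nlinarith [sq_nonneg s]
    obtain ⟨r, hr, hrr⟩ : ∃ r : ℝ, 0 < r ∧ r ^ 2 = 4 * q - s ^ 2 :=
      ⟨√(4 * q - s ^ 2), Real.sqrt_pos.2 (by linarith), Real.sq_sqrt (by linarith)⟩
    have him := h ⟨-s / (2 * q), r / (2 * q)⟩ (by
      apply Complex.ext
      · simp only [pow_two, Complex.add_re, Complex.mul_re, Complex.mul_im, Complex.ofReal_re,
          Complex.ofReal_im, Complex.one_re, Complex.zero_re]
        field_simp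
        linear_combination -q * hrr
      · simp only [pow_two, Complex.add_im, Complex.mul_im, Complex.mul_re, Complex.ofReal_re,
          Complex.ofReal_im, Complex.one_im, Complex.zero_im]
        field_simp
        ring)
    exact (div_pos hr (by positivity)).ne' him
  · rintro h ⟨u, v⟩ hz
    by_contra hv
    change v ≠ 0 at hv
    have hre := congrArg Complex.re hz
    have him := congrArg Complex.im hz
    simp only [pow_two, Complex.add_re, Complex.add_im, Complex.mul_re, Complex.mul_im,
      Complex.ofReal_re, Complex.ofReal_im, Complex.one_re, Complex.one_im, Complex.zero_re,
      Complex.zero_im] at hre him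
    have hs : s = -(2 * q * u) := mul_right_cancel₀ hv (by linarith)
    subst hs
    have hq : q ≠ 0 := by
      rintro rfl
      simp at hre
    have hqv : 0 < (q * v) ^ 2 := by positivity
    nlinarith

theorem aeval_quadratic_smul {n : ℕ} (A : Matrix (Fin n) (Fin n) ℝ) (b a : Fin n → ℝ) (z : ℂ) :
    MvPolynomial.aeval (fun i => z * algebraMap ℝ ℂ (a i))
      ((∑ i, ∑ j, MvPolynomial.C (A i j) * MvPolynomial.X i * MvPolynomial.X j) +
        (∑ i, MvPolynomial.C (b i) * MvPolynomial.X i) + 1) =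
      ((a ⬝ᵥ A *ᵥ a : ℝ) : ℂ) * z ^ 2 + ((b ⬝ᵥ a : ℝ) : ℂ) * z + 1 := by
  simp only [map_add, map_sum, map_mul, map_one, MvPolynomial.aeval_X, MvPolynomial.aeval_C,
    dotProduct, mulVec, Complex.coe_algebraMap, Complex.ofReal_sum, Complex.ofReal_mul,
    Finset.sum_mul, Finset.mul_sum]
  congr 2
  · exact Finset.sum_congr rfl fun i _ => Finset.sum_congr rfl fun j _ => by ring
  · exact Finset.sum_congr rfl fun i _ => by ring

theorem dotProduct_discriminant_mulVec {n : ℕ} (A : Matrix (Fin n) (Fin n) ℝ)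
    (b a : Fin n → ℝ) :
    a ⬝ᵥ (Matrix.of (fun i j => b i * b j) - (4 : ℝ) • A) *ᵥ a =
      (b ⬝ᵥ a) ^ 2 - 4 * (a ⬝ᵥ A *ᵥ a) := by
  change a ⬝ᵥ (vecMulVec b b - (4 : ℝ) • A) *ᵥ a = _
  rw [sub_mulVec, dotProduct_sub, smul_mulVec, dotProduct_smul, vecMulVec_mulVec,
    op_smul_eq_smul, dotProduct_smul, dotProduct_comm a b]
  simp only [smul_eq_mul]
  ring

/-- For `A` a real symmetric `n × n` matrix, `b ∈ ℝⁿ` and `p = xᵀAx + bᵀx + 1`, the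
polynomial `p` is a real-zero polynomial if and only if `b·bᵀ - 4A` is positive
semidefinite. -/
theorem quadratic_isRealZero_iff {n : ℕ} (A : Matrix (Fin n) (Fin n) ℝ) (hA : A.IsSymm)
    (b : Fin n → ℝ) :
    IsRealZero ((∑ i, ∑ j, MvPolynomial.C (A i j) * MvPolynomial.X i * MvPolynomial.X j) +
        (∑ i, MvPolynomial.C (b i) * MvPolynomial.X i) + 1) ↔
      (Matrix.of (fun i j => b i * b j) - (4 : ℝ) • A).PosSemidef := by
  have hherm : (Matrix.of (fun i j => b i * b j) - (4 : ℝ) • A).IsHermitian := by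
    ext i j
    simp [hA.apply i j, mul_comm (b i)]
  simp only [IsRealZero, posSemidef_iff_dotProduct_mulVec, star_trivial,
    dotProduct_discriminant_mulVec, aeval_quadratic_smul, forall_root_im_eq_zero_iff, hherm,
    true_and, and_iff_right_iff_imp]
  simp
end

section
/- Let p = xᵀAx + bᵀx + 1 ∈ ℝ[x₁,…,xₙ] be a real-zero polynomial (A real symmetric, b ∈ ℝⁿ). Then its parametrized Hermite matrix is 𝓗(p) = [[2, −bᵀx], [−bᵀx, xᵀ(b·bᵀ − 2A)x]], and 𝓗(p) is a sum of squares: there exists a matrix 𝓠 of size (n+1)×2 with polynomial entries such that 𝓗(p) = 𝓠ᵀ𝓠. -/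
open Matrix

theorem hermiteM_two_of_isHomogeneous {n : ℕ} {q l : MvPolynomial (Fin n) ℝ}
    (hq : q.IsHomogeneous 2) (hl : l.IsHomogeneous 1) :
    hermiteM 2 (q + l + 1) = !![2, -l; -l, l ^ 2 - 2 * q] := by
  have h1 : (1 : MvPolynomial (Fin n) ℝ).IsHomogeneous 0 := MvPolynomial.isHomogeneous_one _ _
  have hc : companionM 2 (q + l + 1) = !![0, -q; 1, -l] := by
    ext1 i j
    fin_cases i <;> fin_cases j <;>
      simp [companionM, MvPolynomial.homogeneousComponent_of_mem hq,
        MvPolynomial.homogeneousComponent_of_mem hl, MvPolynomial.homogeneousComponent_of_mem h1]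
  ext1 i j
  fin_cases i <;> fin_cases j <;>
    simp [hermiteM, hc, Matrix.trace_fin_two, pow_two]
  ring

/-- A real quadratic `c z² + β z + 1` all of whose complex roots are real has nonnegative
discriminant. -/
theorem four_mul_le_sq_of_roots_real {c β : ℝ}
    (h : ∀ z : ℂ, c * z ^ 2 + β * z + 1 = 0 → z.im = 0) : 4 * c ≤ β ^ 2 := by
  by_contra! hlt
  have hc : 0 < c := by nlinarith [sq_nonneg β]
  set s := √(4 * c - β ^ 2) with hs
  have hspos : 0 < s := Real.sqrt_pos.2 (by linarith)
  have hsq : s ^ 2 = 4 * c - β ^ 2 := Real.sq_sqrt (by linarith)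
  have key := h ⟨-β / (2 * c), s / (2 * c)⟩ (by
    apply Complex.ext
    · simp [pow_two]
      field_simp
      linarith
    · simp [pow_two]
      field_simp
      ring)
  have : 0 < s / (2 * c) := by positivity
  exact this.ne' key

open scoped MatrixOrder in
theorem Matrix.PosSemidef.exists_eq_conjTranspose_mul_self {m : Type*} [Fintype m]
    {M : Matrix m m ℝ} (hM : M.PosSemidef) : ∃ B : Matrix m m ℝ, M = Bᴴ * B := by
  classical
  exact CStarAlgebra.nonneg_iff_eq_star_mul_self.mp hM.nonneg

/-- Let `p = xᵀAx + bᵀx + 1` be a real-zero polynomial (`A` real symmetric, `b ∈ ℝⁿ`).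
Then `𝓗(p) = [[2, -bᵀx], [-bᵀx, xᵀ(b·bᵀ - 2A)x]]`, and `𝓗(p)` is a sum of squares:
`𝓗(p) = 𝓠ᵀ𝓠` for some `(n+1) × 2` polynomial matrix `𝓠`. -/
theorem quadratic_hermite_sos {n : ℕ} (A : Matrix (Fin n) (Fin n) ℝ) (hA : A.IsSymm)
    (b : Fin n → ℝ)
    (hRZ : IsRealZero ((∑ i, ∑ j, MvPolynomial.C (A i j) * MvPolynomial.X i *
        MvPolynomial.X j) + (∑ i, MvPolynomial.C (b i) * MvPolynomial.X i) + 1)) :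
    hermiteM 2 ((∑ i, ∑ j, MvPolynomial.C (A i j) * MvPolynomial.X i * MvPolynomial.X j) +
        (∑ i, MvPolynomial.C (b i) * MvPolynomial.X i) + 1) =
      Matrix.of
        ![![2, -(∑ i, MvPolynomial.C (b i) * MvPolynomial.X i)],
          ![-(∑ i, MvPolynomial.C (b i) * MvPolynomial.X i),
            ∑ i, ∑ j, MvPolynomial.C (b i * b j - 2 * A i j) * MvPolynomial.X i *
              MvPolynomial.X j]] ∧
    ∃ Q : Matrix (Fin (n + 1)) (Fin 2) (MvPolynomial (Fin n) ℝ),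
      hermiteM 2 ((∑ i, ∑ j, MvPolynomial.C (A i j) * MvPolynomial.X i * MvPolynomial.X j) +
          (∑ i, MvPolynomial.C (b i) * MvPolynomial.X i) + 1) = Qᵀ * Q := by
  set q : MvPolynomial (Fin n) ℝ :=
    ∑ i, ∑ j, MvPolynomial.C (A i j) * MvPolynomial.X i * MvPolynomial.X j with hq
  set l : MvPolynomial (Fin n) ℝ := ∑ i, MvPolynomial.C (b i) * MvPolynomial.X i with hl
  have hq2 : q.IsHomogeneous 2 :=
    MvPolynomial.IsHomogeneous.sum _ _ _ fun i _ ↦ MvPolynomial.IsHomogeneous.sum _ _ _ fun j _ ↦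
      (MvPolynomial.isHomogeneous_C_mul_X (A i j) i).mul (MvPolynomial.isHomogeneous_X ℝ j)
  have hl1 : l.IsHomogeneous 1 :=
    MvPolynomial.IsHomogeneous.sum _ _ _ fun i _ ↦ MvPolynomial.isHomogeneous_C_mul_X (b i) i
  have hH := hermiteM_two_of_isHomogeneous hq2 hl1
  have hlsq : l ^ 2 = ∑ i, ∑ j, MvPolynomial.C (b i * b j) * MvPolynomial.X i *
      MvPolynomial.X j := by
    rw [hl, pow_two, Finset.sum_mul_sum]
    refine Finset.sum_congr rfl fun i _ ↦ Finset.sum_congr rfl fun j _ ↦ ?_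
    rw [map_mul]
    ring
  refine ⟨?_, ?_⟩
  · rw [hH, hlsq, hq, Finset.mul_sum, ← Finset.sum_sub_distrib]
    congr! 6 with i
    rw [Finset.mul_sum, ← Finset.sum_sub_distrib]
    refine Finset.sum_congr rfl fun j _ ↦ ?_
    simp only [map_sub, map_mul, map_ofNat]
    ring
  set M : Matrix (Fin n) (Fin n) ℝ := vecMulVec b b - (4 : ℝ) • A with hM
  have hMpsd : M.PosSemidef := by
    refine Matrix.PosSemidef.of_dotProduct_mulVec_nonneg ?_ fun a ↦ ?_
    · ext i j
      simp [hM, vecMulVec_apply, mul_comm (b i), hA.apply i j]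
    · have hdisc : 4 * (a ⬝ᵥ A *ᵥ a) ≤ (b ⬝ᵥ a) ^ 2 := by
        refine four_mul_le_sq_of_roots_real fun z hz ↦ hRZ.2 a z ?_
        rw [← hz, hq, hl]
        simp only [map_add, map_sum, map_mul, map_one, MvPolynomial.aeval_C,
          MvPolynomial.aeval_X, dotProduct, mulVec, Complex.coe_algebraMap,
          Complex.ofReal_sum, Complex.ofReal_mul, Finset.mul_sum, Finset.sum_mul]
        congr 2
        · refine Finset.sum_congr rfl fun i _ ↦ Finset.sum_congr rfl fun j _ ↦ ?_
          ring
        · refine Finset.sum_congr rfl fun i _ ↦ ?_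
          ring
      have : a ⬝ᵥ M *ᵥ a = (b ⬝ᵥ a) ^ 2 - 4 * (a ⬝ᵥ A *ᵥ a) := by
        simp [hM, sub_mulVec, vecMulVec_mulVec, smul_mulVec, dotProduct_comm a b, pow_two]
      simpa [this] using hdisc
  obtain ⟨B, hB⟩ := hMpsd.exists_eq_conjTranspose_mul_self
  set r : ℝ := √2 with hr
  have hr2 : r * r = 2 := Real.mul_self_sqrt (by norm_num)
  have hr0 : r⁻¹ * r⁻¹ = 1 / 2 := by rw [← mul_inv, hr2]; norm_num
  have hrr : r * r⁻¹ = 1 := mul_inv_cancel₀ (by positivity)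
  have hsum : ∑ k, (∑ j, MvPolynomial.C (B k j) * MvPolynomial.X j) ^ 2 = l ^ 2 - 4 * q := by
    have hBij (i j : Fin n) : ∑ k, B k i * B k j = b i * b j - 4 * A i j := by
      have := congr_fun₂ hB i j
      simpa [hM, vecMulVec_apply, mul_apply] using this.symm
    simp_rw [pow_two, Finset.sum_mul_sum]
    rw [← pow_two, hlsq, hq, Finset.mul_sum, ← Finset.sum_sub_distrib, Finset.sum_comm]
    refine Finset.sum_congr rfl fun i _ ↦ ?_
    rw [Finset.mul_sum, ← Finset.sum_sub_distrib, Finset.sum_comm]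
    refine Finset.sum_congr rfl fun j _ ↦ ?_
    have := congr_arg (MvPolynomial.C (σ := Fin n)) (hBij i j)
    simp only [map_sum, map_sub, map_mul, map_ofNat] at this ⊢
    calc
      _ = (∑ k, MvPolynomial.C (B k i) * MvPolynomial.C (B k j)) *
          (MvPolynomial.X i * MvPolynomial.X j) := by
        rw [Finset.sum_mul]
        exact Finset.sum_congr rfl fun k _ ↦ by ring
      _ = _ := by
        rw [this]
        ring
  set u : Fin 2 → MvPolynomial (Fin n) ℝ := ![MvPolynomial.C r, -(MvPolynomial.C r⁻¹ * l)] with hu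
  set v : Fin n → Fin 2 → MvPolynomial (Fin n) ℝ := fun k ↦
    ![0, MvPolynomial.C r⁻¹ * ∑ j, MvPolynomial.C (B k j) * MvPolynomial.X j] with hv
  have hQ (i j : Fin 2) : ((Matrix.of (Fin.cons u v : Fin (n + 1) → Fin 2 → _))ᵀ *
      Matrix.of (Fin.cons u v : Fin (n + 1) → Fin 2 → _)) i j =
      u i * u j + ∑ k, v k i * v k j := by
    simp [mul_apply, Fin.sum_univ_succ]
  have hvv : ∑ k, v k 1 * v k 1 =
      MvPolynomial.C r⁻¹ * MvPolynomial.C r⁻¹ * (l ^ 2 - 4 * q) := by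
    rw [← hsum, Finset.mul_sum]
    refine Finset.sum_congr rfl fun k _ ↦ ?_
    simp only [hv, cons_val_one, cons_val_fin_one]
    ring
  have h2 := congr_arg (MvPolynomial.C (σ := Fin n)) hr2
  have h0 := congr_arg (fun c ↦ 2 * MvPolynomial.C (σ := Fin n) c) hr0
  have h1 := congr_arg (MvPolynomial.C (σ := Fin n)) hrr
  have hhalf : 2 * MvPolynomial.C (σ := Fin n) (1 / 2 : ℝ) = 1 := by
    rw [← map_ofNat (MvPolynomial.C (σ := Fin n) (R := ℝ)), ← map_mul]
    norm_num
  simp only [hhalf] at h0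
  simp only [map_mul, map_ofNat, map_one] at h2 h0 h1
  refine ⟨Matrix.of (Fin.cons u v), ?_⟩
  rw [hH]
  ext1 i j
  rw [hQ]
  fin_cases i <;> fin_cases j
  · simp [hu, hv, h2]
  · simp [hu, hv]
    linear_combination -l * h1
  · simp [hu, hv]
    linear_combination -l * h1
  · simp only [Fin.mk_one, hvv]
    simp [hu]
    linear_combination (2 * q - l ^ 2) * h0
end

section
/- Let A be a real symmetric n×n matrix and b, v₁,…,vₙ ∈ ℝⁿ with b·bᵀ − 4A = Σ_{i=1}^n v_i·v_iᵀ, and let p = xᵀAx + bᵀx + 1. Define the symmetric linear matrix polynomial 𝓜 of size n+1 by 𝓜 = ½·[[−bᵀx, v₁ᵀx, …, vₙᵀx], [v₁ᵀx, −bᵀx, 0, …, 0], …, [vₙᵀx, 0, …, 0, −bᵀx]] (first row and column after the corner given by the v_iᵀx, all diagonal entries −½bᵀx, all other entries 0). Then det(I − 𝓜) = (1 + ½·bᵀx)^{n−1} · p in ℝ[x₁,…,xₙ]. -/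
open Matrix

/-- The determinant of an arrow matrix, multiplied by its repeated diagonal entry `c`. -/
theorem det_arrow_mul {R : Type*} [CommRing R] {n : ℕ}
    (M : Matrix (Fin (n + 1)) (Fin (n + 1)) R) (a c : R) (u : Fin n → R)
    (h00 : M 0 0 = a) (h0s : ∀ j : Fin n, M 0 j.succ = u j)
    (hs0 : ∀ i : Fin n, M i.succ 0 = u i)
    (hss : ∀ i j : Fin n, M i.succ j.succ = if i = j then c else 0) :
    M.det * c = (a * c - ∑ l, u l ^ 2) * c ^ n := by
  let N : Matrix (Fin (n + 1)) (Fin (n + 1)) R :=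
    Matrix.of (Fin.cons (Fin.cons c 0) fun i => Fin.cons (-u i) (Pi.single i 1))
  have hN : N.det = c := by
    rw [Matrix.det_of_isLowerTriangular N]
    · simp [Fin.prod_univ_succ, N]
    · intro i j hij
      have hij : i < j := hij
      induction j using Fin.cases with
      | zero => simp at hij
      | succ j =>
        induction i using Fin.cases with
        | zero => simp [N]
        | succ i =>
          have : i < j := by simpa using hij
          simp [N, this.ne']
  have h00' : (M * N) 0 0 = a * c - ∑ l, u l ^ 2 := by
    simp [Matrix.mul_apply, Fin.sum_univ_succ, N, h00, h0s, pow_two, sub_eq_add_neg]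
  have hs0' : ∀ i : Fin n, (M * N) i.succ 0 = 0 := by
    intro i
    simp [Matrix.mul_apply, Fin.sum_univ_succ, N, hs0, hss, mul_comm]
  have hss' : ∀ i j : Fin n, (M * N) i.succ j.succ = if i = j then c else 0 := by
    intro i j
    simp [Matrix.mul_apply, Fin.sum_univ_succ, N, hss, Pi.single_apply]
  calc M.det * c = (M * N).det := by rw [Matrix.det_mul, hN]
    _ = (a * c - ∑ l, u l ^ 2) * c ^ n := by
      rw [Matrix.det_of_isUpperTriangular]
      · simp [Fin.prod_univ_succ, h00', hss']
      · intro i j hij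
        have hij : j < i := hij
        induction i using Fin.cases with
        | zero => simp at hij
        | succ i =>
          induction j using Fin.cases with
          | zero => exact hs0' i
          | succ j =>
            have : j < i := by simpa using hij
            simp [hss', this.ne']

/-- Cancelling the repeated diagonal entry `c ≠ 0` in `det_arrow_mul`. -/
theorem det_arrow {R : Type*} [CommRing R] [IsDomain R] {n : ℕ}
    (M : Matrix (Fin (n + 2)) (Fin (n + 2)) R) (a c : R) (u : Fin (n + 1) → R) (hc : c ≠ 0)
    (h00 : M 0 0 = a) (h0s : ∀ j : Fin (n + 1), M 0 j.succ = u j)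
    (hs0 : ∀ i : Fin (n + 1), M i.succ 0 = u i)
    (hss : ∀ i j : Fin (n + 1), M i.succ j.succ = if i = j then c else 0) :
    M.det = c ^ n * (a * c - ∑ l, u l ^ 2) := by
  apply mul_right_cancel₀ hc
  rw [det_arrow_mul M a c u h00 h0s hs0 hss]
  ring

/-- The decomposition `b·bᵀ - 4A = Σ_l v_l·v_lᵀ` as an identity of quadratic forms. -/
theorem sq_sub_four_mul_quadraticForm_eq_sum_sq {n : ℕ} (A : Matrix (Fin n) (Fin n) ℝ)
    (b : Fin n → ℝ) (v : Fin n → Fin n → ℝ)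
    (hv : Matrix.of (fun i j => b i * b j) - (4 : ℝ) • A =
      ∑ l, Matrix.of (fun i j => v l i * v l j)) :
    (∑ i, MvPolynomial.C (b i) * MvPolynomial.X i : MvPolynomial (Fin n) ℝ) ^ 2 -
      4 * (∑ i, ∑ j, MvPolynomial.C (A i j) * MvPolynomial.X i * MvPolynomial.X j) =
      ∑ l, (∑ i, MvPolynomial.C (v l i) * MvPolynomial.X i) ^ 2 := by
  have hA : ∀ i j, b i * b j - 4 * A i j = ∑ l, v l i * v l j := by
    intro i j
    simpa [Matrix.sum_apply] using congrFun (congrFun hv i) j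
  have hsq : ∀ f : Fin n → ℝ,
      (∑ i, MvPolynomial.C (f i) * MvPolynomial.X i : MvPolynomial (Fin n) ℝ) ^ 2 =
      ∑ i, ∑ j, MvPolynomial.C (f i * f j) * (MvPolynomial.X i * MvPolynomial.X j) := by
    intro f
    rw [pow_two, Finset.sum_mul_sum]
    refine Finset.sum_congr rfl fun i _ => Finset.sum_congr rfl fun j _ => ?_
    rw [MvPolynomial.C_mul]
    ring
  simp only [hsq]
  rw [Finset.sum_comm, Finset.mul_sum, ← Finset.sum_comm, ← Finset.sum_sub_distrib,
    Finset.sum_comm]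
  refine Finset.sum_congr rfl fun i _ => ?_
  rw [Finset.sum_comm, Finset.mul_sum, ← Finset.sum_sub_distrib]
  refine Finset.sum_congr rfl fun j _ => ?_
  rw [← Finset.sum_mul, ← map_sum, ← hA, MvPolynomial.C_sub, MvPolynomial.C_mul (a := 4),
    map_ofNat]
  ring

/-- Let `A` be real symmetric, `b, v₁, …, vₙ ∈ ℝⁿ` with `b·bᵀ - 4A = Σ_l v_l·v_lᵀ`, and
`p = xᵀAx + bᵀx + 1`. Let `𝓜` be the symmetric linear matrix polynomial of size `n + 1`
with corner entry `-½bᵀx`, first row/column `½vₗᵀx`, diagonal entries `-½bᵀx`, and zeros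
elsewhere. Then `det(I - 𝓜) = (1 + ½bᵀx)^{n-1} · p`. -/
theorem quadratic_determinantal_identity {n : ℕ} (A : Matrix (Fin n) (Fin n) ℝ)
    (hA : A.IsSymm) (b : Fin n → ℝ) (v : Fin n → Fin n → ℝ)
    (hv : Matrix.of (fun i j => b i * b j) - (4 : ℝ) • A =
      ∑ l, Matrix.of (fun i j => v l i * v l j)) :
    letI β : MvPolynomial (Fin n) ℝ := ∑ i, MvPolynomial.C (b i) * MvPolynomial.X i
    letI w : Fin n → MvPolynomial (Fin n) ℝ :=
      fun l => ∑ i, MvPolynomial.C (v l i) * MvPolynomial.X i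
    letI Mm : Matrix (Fin (n + 1)) (Fin (n + 1)) (MvPolynomial (Fin n) ℝ) := fun i j =>
      MvPolynomial.C (2⁻¹ : ℝ) *
        (if hi : i = 0 then (if hj : j = 0 then -β else w (j.pred hj))
         else if hj : j = 0 then w (i.pred hi)
         else if i = j then -β else 0)
    letI p : MvPolynomial (Fin n) ℝ :=
      (∑ i, ∑ j, MvPolynomial.C (A i j) * MvPolynomial.X i * MvPolynomial.X j) + β + 1
    Matrix.det (1 - Mm) = (1 + MvPolynomial.C (2⁻¹ : ℝ) * β) ^ (n - 1) * p := by
  set β : MvPolynomial (Fin n) ℝ := ∑ i, MvPolynomial.C (b i) * MvPolynomial.X i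
  set w : Fin n → MvPolynomial (Fin n) ℝ :=
    fun l => ∑ i, MvPolynomial.C (v l i) * MvPolynomial.X i
  set Mm : Matrix (Fin (n + 1)) (Fin (n + 1)) (MvPolynomial (Fin n) ℝ) := fun i j =>
    MvPolynomial.C (2⁻¹ : ℝ) *
      (if hi : i = 0 then (if hj : j = 0 then -β else w (j.pred hj))
       else if hj : j = 0 then w (i.pred hi)
       else if i = j then -β else 0)
  rcases n with _ | n
  · rw [Matrix.det_fin_one, Matrix.sub_apply]
    simp [Mm, β]
  have h2 : (MvPolynomial.C (2⁻¹ : ℝ) : MvPolynomial (Fin (n + 1)) ℝ) * 2 = 1 := by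
    rw [← map_ofNat (MvPolynomial.C (R := ℝ) (σ := Fin (n + 1))) 2, ← MvPolynomial.C_mul]
    norm_num
  have hc : (1 + MvPolynomial.C (2⁻¹ : ℝ) * β) ≠ 0 := by
    intro h
    simpa [β] using congrArg MvPolynomial.constantCoeff h
  rw [det_arrow (1 - Mm) (1 + MvPolynomial.C (2⁻¹ : ℝ) * β) (1 + MvPolynomial.C (2⁻¹ : ℝ) * β)
    (fun l => -(MvPolynomial.C (2⁻¹ : ℝ) * w l)) hc]
  · have key : β ^ 2 - 4 * (∑ i, ∑ j, MvPolynomial.C (A i j) * MvPolynomial.X i *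
        MvPolynomial.X j) = ∑ l, w l ^ 2 := sq_sub_four_mul_quadraticForm_eq_sum_sq A b v hv
    simp only [neg_sq, mul_pow, ← Finset.mul_sum, ← key, add_tsub_cancel_right]
    congr 1
    generalize (∑ i, ∑ j, MvPolynomial.C (A i j) * MvPolynomial.X i *
        MvPolynomial.X j : MvPolynomial (Fin (n + 1)) ℝ) = q
    generalize (MvPolynomial.C (2⁻¹ : ℝ) : MvPolynomial (Fin (n + 1)) ℝ) = k at h2 ⊢
    linear_combination (β + (2 * k + 1) * q) * h2
  · rw [Matrix.sub_apply]
    simp [Mm]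
  · intro j
    rw [Matrix.sub_apply]
    simp [Mm, (Fin.succ_ne_zero j).symm]
  · intro i
    rw [Matrix.sub_apply]
    simp [Mm]
  · intro i j
    rw [Matrix.sub_apply]
    by_cases h : i = j <;> simp [Mm, Matrix.one_apply, h]
end
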